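/- Let S' ⊆ ℕ² be a local good semigroup with S' ≠ ℕ²(1,1), with Frobenius vector f(S') = (f₁,f₂) ∉ S'. Let p = |{i ∈ {1,2} : f_i ≠ 0}|. Then S' has exactly p special parents. -/

import Mathlib

/-- The ambient space `ℤ²`; `ℕ²` is identified with the nonnegative orthant. -/
abbrev Z2 : Type := ℤ × ℤ

/-- The nonnegative orthant, representing `ℕ² ⊆ ℤ²`. -/
def orth : Set Z2 := {a : Z2 | 0 ≤ a.1 ∧ 0 ≤ a.2}

/-- Property (G1): closure under componentwise minimum. -/
def MinClosed (E : Set Z2) : Prop := ∀ a ∈ E, ∀ b ∈ E, a ⊓ b ∈ E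

/-- Property (G3). -/
def G3P (E : Set Z2) : Prop :=
  ∀ a ∈ E, ∀ b ∈ E, a ≠ b →
    (a.1 = b.1 →
      ∃ e ∈ E, a.1 < e.1 ∧ min a.2 b.2 ≤ e.2 ∧ (a.2 ≠ b.2 → e.2 = min a.2 b.2)) ∧
    (a.2 = b.2 →
      ∃ e ∈ E, a.2 < e.2 ∧ min a.1 b.1 ≤ e.1 ∧ (a.1 ≠ b.1 → e.1 = min a.1 b.1))

/-- A good semigroup of `ℕ²` (viewed inside `ℤ²`). -/
def IsGood (S : Set Z2) : Prop :=
  S ⊆ orth ∧ (0 : Z2) ∈ S ∧ (∀ a ∈ S, ∀ b ∈ S, a + b ∈ S) ∧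
  MinClosed S ∧ (∃ δ : Z2, ∀ y : Z2, δ ≤ y → y ∈ S) ∧ G3P S

/-- A good semigroup is local if its only element with a zero coordinate is `0`. -/
def IsLocal (S : Set Z2) : Prop := ∀ a ∈ S, (a.1 = 0 ∨ a.2 = 0) → a = 0

/-- A relative good ideal of `S`. -/
def IsRelGoodIdeal (S E : Set Z2) : Prop :=
  E.Nonempty ∧ (∀ e ∈ E, ∀ s ∈ S, e + s ∈ E) ∧ (∃ a ∈ S, ∀ e ∈ E, a + e ∈ S) ∧
  MinClosed E ∧ G3P E

/-- A saturated chain of length `n` in `E`. -/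
def IsSatChain (E : Set Z2) (n : ℕ) (f : ℕ → Z2) : Prop :=
  (∀ i ≤ n, f i ∈ E) ∧ (∀ i < n, f i < f (i + 1)) ∧
  (∀ i < n, ∀ c ∈ E, ¬ (f i < c ∧ c < f (i + 1)))

/-- `d_E(a,b)`: the common length of all saturated chains in `E` from `a` to `b`. -/
noncomputable def chainDist (E : Set Z2) (a b : Z2) : ℕ :=
  sSup {n : ℕ | ∃ f : ℕ → Z2, IsSatChain E n f ∧ f 0 = a ∧ f n = b}

/-- The (componentwise) minimal element `e(E)` of `E`. -/
noncomputable def minEl (E : Set Z2) : Z2 :=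
  (sInf (Prod.fst '' E), sInf (Prod.snd '' E))

/-- The distance `d(E∖F)` between `F ⊆ E`: the common value of
`d_E(e(E),α) - d_F(e(F),α)` for all sufficiently large `α ∈ F`. -/
noncomputable def dist2 (E F : Set Z2) : ℤ :=
  sSup {z : ℤ | ∃ β : Z2, ∀ α ∈ F, β ≤ α →
    (chainDist E (minEl E) α : ℤ) - (chainDist F (minEl F) α : ℤ) = z}

/-- The conductor `c(E)`: the componentwise minimal `δ` with `δ + ℕ² ⊆ E`. -/
noncomputable def condE (E : Set Z2) : Z2 :=
  (sInf ((fun δ : Z2 => δ.1) '' {δ : Z2 | ∀ y : Z2, δ ≤ y → y ∈ E}),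
   sInf ((fun δ : Z2 => δ.2) '' {δ : Z2 | ∀ y : Z2, δ ≤ y → y ∈ E}))

/-- The conductor ideal `C(E) = {β ∈ E : β ≥ c(E)}`. -/
noncomputable def CIdeal (E : Set Z2) : Set Z2 := {b ∈ E | condE E ≤ b}

/-- The length `l(E) = d(E ∖ C(E))`. -/
noncomputable def glen (E : Set Z2) : ℤ := dist2 E (CIdeal E)

/-- The genus `g(E) = d(ℕ² ∖ E)`. -/
noncomputable def genus (E : Set Z2) : ℤ := dist2 orth E

/-- The good semigroup `ℕ²(1,1) = {0} ∪ ((1,1) + ℕ²)`. -/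
def N2oneone : Set Z2 := {a : Z2 | a = 0 ∨ ((1 : ℤ), (1 : ℤ)) ≤ a}
/-- The space `(ℕ ∪ {∞})²`, modelled inside `(ℤ ∪ {∞})²`. -/
abbrev Om : Type := WithTop ℤ × WithTop ℤ

/-- The embedding of `ℤ²` into `(ℤ ∪ {∞})²`. -/
def iotaZ (a : Z2) : Om := ((a.1 : WithTop ℤ), (a.2 : WithTop ℤ))

/-- `S^∞`: the elements `(a,∞)` with `(a,c₂) ∈ S` and `(∞,b)` with `(c₁,b) ∈ S`,
where `(c₁,c₂)` is the conductor of `S`. -/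
noncomputable def Sinf (S : Set Z2) : Set Om :=
  {w : Om | (∃ a : ℤ, w = ((a : WithTop ℤ), ⊤) ∧ (a, (condE S).2) ∈ S) ∨
            (∃ b : ℤ, w = (⊤, (b : WithTop ℤ)) ∧ ((condE S).1, b) ∈ S)}

/-- `Γ_S = S ∪ S^∞`. -/
noncomputable def Gam (S : Set Z2) : Set Om := iotaZ '' S ∪ Sinf S

/-- `I(S)`: the set of irreducible elements of `Γ_S`. -/
noncomputable def ISet (S : Set Z2) : Set Om :=
  {w ∈ Gam S | w ≠ 0 ∧ ∀ b ∈ Gam S, ∀ c ∈ Gam S, w = b + c → w = b ∨ w = c}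

/-- `Δ(a) = Δ₁(a) ∪ Δ₂(a)` for a finite element `a ∈ ℤ²`. -/
def DeltaUp (a : Z2) : Set Z2 :=
  {b : Z2 | (b.1 = a.1 ∧ a.2 < b.2) ∨ (b.2 = a.2 ∧ a.1 < b.1)}

/-- `A_f(S)`: the finite maximals of `S`, i.e. `a ∈ S` with `Δ^S(a) = ∅`. -/
def Af (S : Set Z2) : Set Z2 := {a ∈ S | S ∩ DeltaUp a = ∅}

/-- `I_A(S)`: the irreducible maximals, i.e. irreducible elements of
`A(S) = A_f(S) ∪ S^∞`. -/
noncomputable def IA (S : Set Z2) : Set Om := ISet S ∩ (iotaZ '' Af S ∪ Sinf S)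

/-- `₁Δ(w)` (as a subset of `ℤ²`), including the conventions for infinite `w`. -/
def lowD1 (w : Om) : Set Z2 :=
  {b : Z2 | (b.1 : WithTop ℤ) = w.1 ∧ (b.2 : WithTop ℤ) < w.2}

/-- `₂Δ(w)` (as a subset of `ℤ²`), including the conventions for infinite `w`. -/
def lowD2 (w : Om) : Set Z2 :=
  {b : Z2 | (b.2 : WithTop ℤ) = w.2 ∧ (b.1 : WithTop ℤ) < w.1}

/-- `Δ(w)` (as a subset of `ℤ²`) for a possibly infinite `w`. -/
def upD (w : Om) : Set Z2 :=
  {b : Z2 | ((b.1 : WithTop ℤ) = w.1 ∧ w.2 < (b.2 : WithTop ℤ)) ∨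
            ((b.2 : WithTop ℤ) = w.2 ∧ w.1 < (b.1 : WithTop ℤ))}

/-- `{w} ∩ ℤ²`: the singleton of `w` if `w` is finite, `∅` otherwise. -/
def finPart (w : Om) : Set Z2 := {b : Z2 | iotaZ b = w}

/-- `a` and `b` are connected by a piece of track. -/
def Piece (S : Set Z2) (a b : Om) : Prop :=
  ¬ a ≤ b ∧ ¬ b ≤ a ∧ ∀ s ∈ S, s ∈ upD (a ⊓ b) → iotaZ s ∈ ISet S

/-- The data `α 0, …, α (n-1)` of a track of `S` (with `n ≥ 1` points;
`n = 1` gives the one-point tracks `T((α))`). -/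
def TrackData (S : Set Z2) (n : ℕ) (α : ℕ → Om) : Prop :=
  1 ≤ n ∧ (∀ i < n, α i ∈ IA S) ∧
  (∀ i j, i < j → j < n → (α i).1 < (α j).1) ∧
  (∀ s ∈ S, s ∈ lowD2 (α 0) → iotaZ s ∈ ISet S) ∧
  (∀ s ∈ S, s ∈ lowD1 (α (n - 1)) → iotaZ s ∈ ISet S) ∧
  (∀ i, i + 1 < n → Piece S (α i) (α (i + 1)))

/-- The track `T((α 0,…,α (n-1)))` as a subset of `S`. -/
def trackSet (S : Set Z2) (n : ℕ) (α : ℕ → Om) : Set Z2 :=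
  finPart (α 0) ∪ S ∩ lowD2 (α 0) ∪
  (⋃ i ∈ Finset.range (n - 1), S ∩ upD (α i ⊓ α (i + 1))) ∪
  S ∩ lowD1 (α (n - 1)) ∪ finPart (α (n - 1))

/-- `T` is a track of `S`. -/
def IsTrack (S T : Set Z2) : Prop :=
  ∃ (n : ℕ) (α : ℕ → Om), TrackData S n α ∧ T = trackSet S n α

/-- `T` is a beyond track of `S`: a track meeting `{a ∈ S : a ≥ c(S)}`. -/
noncomputable def IsBeyondTrack (S T : Set Z2) : Prop :=
  IsTrack S T ∧ (T ∩ {a ∈ S | condE S ≤ a}).Nonempty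

/-- `S` is a special parent of `S'`: `S` is a (local) good semigroup and
`S' = S ∖ T` for some beyond track `T` of `S`. -/
noncomputable def SpecialParent (S S' : Set Z2) : Prop :=
  IsGood S ∧ IsLocal S ∧ ∃ T : Set Z2, IsBeyondTrack S T ∧ S' = S \ T

/-! ### Good semigroups and their conductor -/

/-- The reflection of a subset of `ℤ²` exchanging the two coordinates. -/
def reflect (S : Set Z2) : Set Z2 := {p | (p.2, p.1) ∈ S}

theorem IsGood.reflect {S : Set Z2} (h : IsGood S) : IsGood (reflect S) := by
  obtain ⟨h0, h1, h2, h3, ⟨δ, h4⟩, h5⟩ := h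
  refine ⟨fun p hp => (h0 hp).symm, h1, fun a ha b hb => h2 _ ha _ hb,
    fun a ha b hb => h3 _ ha _ hb, ⟨(δ.2, δ.1), fun y hy => h4 _ ⟨hy.2, hy.1⟩⟩, ?_⟩
  intro a ha b hb hab
  have hab' : (a.2, a.1) ≠ (b.2, b.1) := by
    intro h
    simp only [Prod.mk.injEq] at h
    exact hab (Prod.ext h.2 h.1)
  obtain ⟨k1, k2⟩ := h5 _ ha _ hb hab'
  constructor
  · intro h
    obtain ⟨e, he, h'⟩ := k2 h
    exact ⟨(e.2, e.1), he, h'⟩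
  · intro h
    obtain ⟨e, he, h'⟩ := k1 h
    exact ⟨(e.2, e.1), he, h'⟩

theorem IsLocal.reflect {S : Set Z2} (h : IsLocal S) : IsLocal (reflect S) := by
  intro a ha hz
  have := h _ ha hz.symm
  simp only [Prod.mk_eq_zero] at this
  exact Prod.ext this.2 this.1

theorem condE_reflect (S : Set Z2) : condE (reflect S) = ((condE S).2, (condE S).1) := by
  have key : ∀ δ : Z2, (∀ y : Z2, δ ≤ y → y ∈ reflect S) ↔
      ∀ y : Z2, (δ.2, δ.1) ≤ y → y ∈ S := fun δ =>
    ⟨fun h y hy => h (y.2, y.1) ⟨hy.2, hy.1⟩, fun h y hy => h (y.2, y.1) ⟨hy.2, hy.1⟩⟩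
  unfold condE
  congr 2
  · ext x
    constructor
    · rintro ⟨δ, h, rfl⟩
      exact ⟨(δ.2, δ.1), (key δ).1 h, rfl⟩
    · rintro ⟨δ, h, rfl⟩
      exact ⟨(δ.2, δ.1), (key _).2 h, rfl⟩
  · ext x
    constructor
    · rintro ⟨δ, h, rfl⟩
      exact ⟨(δ.2, δ.1), (key δ).1 h, rfl⟩
    · rintro ⟨δ, h, rfl⟩
      exact ⟨(δ.2, δ.1), (key _).2 h, rfl⟩

theorem IsGood.bddBelow_fst {S : Set Z2} (h : IsGood S) :
    BddBelow ((fun δ : Z2 => δ.1) '' {δ : Z2 | ∀ y : Z2, δ ≤ y → y ∈ S}) := by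
  refine ⟨0, ?_⟩
  rintro _ ⟨δ, hδ, rfl⟩
  exact (h.1 (hδ δ le_rfl)).1

theorem IsGood.bddBelow_snd {S : Set Z2} (h : IsGood S) :
    BddBelow ((fun δ : Z2 => δ.2) '' {δ : Z2 | ∀ y : Z2, δ ≤ y → y ∈ S}) := by
  refine ⟨0, ?_⟩
  rintro _ ⟨δ, hδ, rfl⟩
  exact (h.1 (hδ δ le_rfl)).2

theorem IsGood.condE_le {S : Set Z2} (h : IsGood S) {δ : Z2}
    (hδ : ∀ y : Z2, δ ≤ y → y ∈ S) : condE S ≤ δ :=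
  ⟨csInf_le h.bddBelow_fst ⟨δ, hδ, rfl⟩, csInf_le h.bddBelow_snd ⟨δ, hδ, rfl⟩⟩

theorem IsGood.mem_of_condE_le {S : Set Z2} (h : IsGood S) {y : Z2} (hy : condE S ≤ y) :
    y ∈ S := by
  obtain ⟨δ₀, hδ₀⟩ := h.2.2.2.2.1
  obtain ⟨δ, hδ, h1⟩ := Int.csInf_mem (s := (fun δ : Z2 => δ.1) ''
    {δ : Z2 | ∀ y : Z2, δ ≤ y → y ∈ S}) ⟨_, δ₀, hδ₀, rfl⟩ h.bddBelow_fst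
  obtain ⟨ε, hε, h2⟩ := Int.csInf_mem (s := (fun δ : Z2 => δ.2) ''
    {δ : Z2 | ∀ y : Z2, δ ≤ y → y ∈ S}) ⟨_, δ₀, hδ₀, rfl⟩ h.bddBelow_snd
  have hy1 : δ.1 ≤ y.1 := h1.trans_le hy.1
  have hy2 : ε.2 ≤ y.2 := h2.trans_le hy.2
  have m := h.2.2.2.1 _ (hδ (y.1, max y.2 δ.2) ⟨hy1, le_max_right _ _⟩) _
    (hε (max y.1 ε.1, y.2) ⟨le_max_right _ _, hy2⟩)
  have e : ((y.1, max y.2 δ.2) : Z2) ⊓ (max y.1 ε.1, y.2) = y :=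
    Prod.ext (min_eq_left (le_max_left _ _)) (min_eq_right (le_max_left _ _))
  rwa [e] at m

theorem IsGood.mem_min {S : Set Z2} (h : IsGood S) {x y x' y' : ℤ} (ha : (x, y) ∈ S)
    (hb : (x', y') ∈ S) : (min x x', min y y') ∈ S :=
  h.2.2.2.1 _ ha _ hb

theorem IsGood.exists_right {S : Set Z2} (h : IsGood S) {x y y' : ℤ} (hy : y < y')
    (ha : (x, y) ∈ S) (hb : (x, y') ∈ S) : ∃ x', x < x' ∧ (x', y) ∈ S := by
  have hne : ((x, y) : Z2) ≠ (x, y') := fun h => hy.ne (congrArg Prod.snd h)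
  obtain ⟨e, he, h1, -, h2⟩ := (h.2.2.2.2.2 _ ha _ hb hne).1 rfl
  have h3 : e.2 = y := (h2 hy.ne).trans (min_eq_left hy.le)
  exact ⟨e.1, h1, by rwa [← h3]⟩

theorem IsGood.exists_above {S : Set Z2} (h : IsGood S) {x x' y : ℤ} (hx : x < x')
    (ha : (x, y) ∈ S) (hb : (x', y) ∈ S) : ∃ y', y < y' ∧ (x, y') ∈ S :=
  h.reflect.exists_right (x := y) (y := x) (y' := x') hx ha hb

/-- Beyond the conductor, membership in `S` does not depend on the first coordinate. -/
theorem IsGood.mem_row {S : Set Z2} (h : IsGood S) {X x b : ℤ} (hX : (condE S).1 ≤ X)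
    (hx : (condE S).1 ≤ x) (hb : (X, b) ∈ S) : (x, b) ∈ S := by
  rcases le_or_gt (condE S).2 b with hc | hc
  · exact h.mem_of_condE_le ⟨hx, hc⟩
  have far : ∀ n : ℕ, ∃ X', (condE S).1 ≤ X' ∧ X + n ≤ X' ∧ (X', b) ∈ S := by
    intro n
    induction n with
    | zero => exact ⟨X, hX, by simp, hb⟩
    | succ n ih =>
      obtain ⟨X', h1, h2, h3⟩ := ih
      obtain ⟨X'', h4, h5⟩ := h.exists_right hc h3 (h.mem_of_condE_le (y := (X', _)) ⟨h1, le_rfl⟩)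
      exact ⟨X'', by omega, by push_cast; omega, h5⟩
  obtain ⟨X', -, h2, h3⟩ := far (x - X).toNat
  have m := h.mem_min h3 (h.mem_of_condE_le (y := (x, (condE S).2)) ⟨hx, le_rfl⟩)
  rwa [min_eq_right (by omega), min_eq_left hc.le] at m

/-- Beyond the conductor, membership in `S` does not depend on the second coordinate. -/
theorem IsGood.mem_column {S : Set Z2} (h : IsGood S) {Y y a : ℤ} (hY : (condE S).2 ≤ Y)
    (hy : (condE S).2 ≤ y) (ha : (a, Y) ∈ S) : (a, y) ∈ S :=
  h.reflect.mem_row (X := Y) (x := y) (b := a) (by rwa [condE_reflect])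
    (by rwa [condE_reflect]) ha

theorem IsGood.frobenius_column {S : Set Z2} (h : IsGood S) {y : ℤ} (hy : (condE S).2 ≤ y) :
    ((condE S).1 - 1, y) ∉ S := by
  intro hm
  have : condE S ≤ ((condE S).1 - 1, (condE S).2) := by
    refine h.condE_le fun z hz => ?_
    have h1 : (condE S).1 - 1 ≤ z.1 := hz.1
    have h2 : (condE S).2 ≤ z.2 := hz.2
    rcases h1.eq_or_lt with h1 | h1
    · have := h.mem_column hy h2 hm
      rwa [h1] at this
    · exact h.mem_of_condE_le ⟨by omega, h2⟩
  have : (condE S).1 ≤ (condE S).1 - 1 := this.1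
  omega

theorem IsGood.one_le_condE_fst {S : Set Z2} (h : IsGood S) (hl : IsLocal S) :
    1 ≤ (condE S).1 := by
  have h0 := h.1 (h.mem_of_condE_le le_rfl)
  have h1 : 0 ≤ (condE S).1 := h0.1
  have h2 : 0 ≤ (condE S).2 := h0.2
  by_contra hc
  have h3 := hl _ (h.mem_of_condE_le (y := ((condE S).1, (condE S).2 + 1)) ⟨le_rfl, by simp⟩)
    (Or.inl (by simp only; omega))
  simp only [Prod.mk_eq_zero] at h3
  omega

theorem IsGood.one_le_condE_snd {S : Set Z2} (h : IsGood S) (hl : IsLocal S) :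
    1 ≤ (condE S).2 := by
  have := h.reflect.one_le_condE_fst hl.reflect
  rwa [condE_reflect] at this

/-! ### The shape of beyond tracks -/

/-- The possible shapes of a beyond track of `S`: a column, a row, or the union of a half column
and a half row, reaching beyond the conductor. -/
def BeyondShape (S T : Set Z2) : Prop :=
  (∃ a, (condE S).1 ≤ a ∧ T = S ∩ {p | p.1 = a}) ∨
  (∃ b, (condE S).2 ≤ b ∧ T = S ∩ {p | p.2 = b}) ∨
  (∃ a b, ((condE S).1 ≤ a ∨ (condE S).2 ≤ b) ∧ (a, (condE S).2) ∈ S ∧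
    ((condE S).1, b) ∈ S ∧ T = S ∩ DeltaUp (a, b))

theorem BeyondShape.reflect {S T : Set Z2} (h : BeyondShape S T) :
    BeyondShape (reflect S) (reflect T) := by
  unfold BeyondShape
  rw [condE_reflect]
  rcases h with ⟨a, ha, rfl⟩ | ⟨b, hb, rfl⟩ | ⟨a, b, hab, ha, hb, rfl⟩
  · exact Or.inr (Or.inl ⟨a, ha, rfl⟩)
  · exact Or.inl ⟨b, hb, rfl⟩
  · refine Or.inr (Or.inr ⟨b, a, hab.symm, hb, ha, ?_⟩)
    ext p
    exact and_congr_right fun _ => or_comm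

theorem mem_IA_cases {S : Set Z2} (h : IsGood S) {w : Om} (hw : w ∈ IA S) :
    (∃ p : Z2, w = iotaZ p ∧ p.1 < (condE S).1 ∧ p.2 < (condE S).2) ∨
    (∃ a : ℤ, w = ((a : WithTop ℤ), ⊤) ∧ (a, (condE S).2) ∈ S) ∨
    (∃ b : ℤ, w = (⊤, (b : WithTop ℤ)) ∧ ((condE S).1, b) ∈ S) := by
  rcases hw.2 with ⟨p, ⟨hp, hmax⟩, rfl⟩ | hw
  · refine Or.inl ⟨p, rfl, ?_, ?_⟩
    · by_contra! hc
      exact hmax.subset ⟨h.mem_row (b := p.2) hc (x := p.1 + 1) (by omega) hp,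
        Or.inr ⟨rfl, by simp⟩⟩
    · by_contra! hc
      exact hmax.subset ⟨h.mem_column (a := p.1) hc (y := p.2 + 1) (by omega) hp,
        Or.inl ⟨rfl, by simp⟩⟩
  · exact Or.inr hw

theorem upD_inf (a b : ℤ) :
    upD (((a : WithTop ℤ), ⊤) ⊓ (⊤, (b : WithTop ℤ))) = DeltaUp (a, b) := by
  ext p
  simp [upD, DeltaUp]

theorem trackSet_column (S : Set Z2) {α : ℕ → Om} {a : ℤ} (h : α 0 = ((a : WithTop ℤ), ⊤)) :
    trackSet S 1 α = S ∩ {p | p.1 = a} := by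
  ext p
  simp [trackSet, h, finPart, lowD1, lowD2, iotaZ]

theorem trackSet_row (S : Set Z2) {α : ℕ → Om} {b : ℤ} (h : α 0 = (⊤, (b : WithTop ℤ))) :
    trackSet S 1 α = S ∩ {p | p.2 = b} := by
  ext p
  simp [trackSet, h, finPart, lowD1, lowD2, iotaZ]

theorem trackSet_corner (S : Set Z2) {α : ℕ → Om} {a b : ℤ} (h0 : α 0 = ((a : WithTop ℤ), ⊤))
    (h1 : α 1 = (⊤, (b : WithTop ℤ))) : trackSet S 2 α = S ∩ DeltaUp (a, b) := by
  ext p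
  simp only [trackSet, ← upD_inf, h0, h1, finPart, lowD1, lowD2, iotaZ]
  simp [h0, h1]

theorem TrackData.eq_zero_of_column {S : Set Z2} {n : ℕ} {α : ℕ → Om} (h : TrackData S n α)
    {i : ℕ} (hi : i < n) {a : ℤ} (ha : α i = ((a : WithTop ℤ), ⊤)) : i = 0 := by
  obtain ⟨-, -, hmono, -, -, hp⟩ := h
  rcases i with _ | i
  · rfl
  · refine absurd ?_ (hp i hi).1
    have := hmono i (i + 1) (by omega) hi
    rw [ha] at this ⊢
    exact ⟨this.le, le_top⟩

theorem TrackData.eq_last_of_row {S : Set Z2} {n : ℕ} {α : ℕ → Om} (h : TrackData S n α)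
    {i : ℕ} (hi : i < n) {b : ℤ} (hb : α i = (⊤, (b : WithTop ℤ))) : i + 1 = n := by
  obtain ⟨-, -, hmono, -, -, -⟩ := h
  by_contra hc
  have := hmono i (i + 1) (by omega) (by omega)
  rw [hb] at this
  exact not_top_lt this

theorem TrackData.snd_lt {S : Set Z2} {n : ℕ} {α : ℕ → Om} (h : TrackData S n α)
    {i : ℕ} (hi : i + 1 < n) : (α (i + 1)).2 < (α i).2 := by
  obtain ⟨-, -, hmono, -, -, hp⟩ := h
  by_contra! hc
  exact (hp i hi).1 ⟨(hmono i (i + 1) (by omega) hi).le, hc⟩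

theorem beyondShape_of_corner {S : Set Z2} {n : ℕ} {α : ℕ → Om} (hd : TrackData S n α)
    {i : ℕ} (hi : i + 1 < n) {a b : ℤ} (ha : α i = ((a : WithTop ℤ), ⊤))
    (hb : α (i + 1) = (⊤, (b : WithTop ℤ))) (haS : (a, (condE S).2) ∈ S)
    (hbS : ((condE S).1, b) ∈ S) (hab : (condE S).1 ≤ a ∨ (condE S).2 ≤ b) :
    BeyondShape S (trackSet S n α) := by
  obtain rfl := hd.eq_zero_of_column (by omega) ha
  obtain rfl := hd.eq_last_of_row hi hb
  exact Or.inr (Or.inr ⟨a, b, hab, haS, hbS, trackSet_corner S ha hb⟩)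

theorem IsBeyondTrack.beyondShape {S T : Set Z2} (h : IsGood S) (hT : IsBeyondTrack S T) :
    BeyondShape S T := by
  obtain ⟨⟨n, α, hd, rfl⟩, t, ht, htS, hct⟩ := hT
  have hn := hd.1
  have hIA := fun i (hi : i < n) => mem_IA_cases h (hd.2.1 i hi)
  have c1 : (condE S).1 ≤ t.1 := hct.1
  have c2 : (condE S).2 ≤ t.2 := hct.2
  have nofin : ∀ i < n, iotaZ t ≠ α i := by
    intro i hi he
    rcases hIA i hi with ⟨p, hp, hp1, hp2⟩ | ⟨a, ha, -⟩ | ⟨b, hb, -⟩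
    · rw [hp] at he
      simp only [iotaZ, Prod.mk.injEq, WithTop.coe_inj] at he
      omega
    · rw [ha] at he
      simp [iotaZ] at he
    · rw [hb] at he
      simp [iotaZ] at he
  have hti := ht
  simp only [trackSet, Set.mem_union, Set.mem_iUnion, Finset.mem_range] at hti
  rcases hti with (((ht | ⟨-, ht1, ht2⟩) | ⟨i, hi, -, ht⟩) | ⟨-, ht1, ht2⟩) | ht
  · exact absurd ht (nofin 0 (by omega))
  · rcases hIA 0 (by omega) with ⟨p, hp, hp1, hp2⟩ | ⟨a, ha, -⟩ | ⟨b, hb, -⟩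
    · rw [hp] at ht1
      simp only [iotaZ, WithTop.coe_inj] at ht1
      omega
    · rw [ha] at ht1
      simp at ht1
    · obtain rfl := hd.eq_last_of_row (by omega) hb
      rw [hb] at ht1
      simp only [WithTop.coe_inj] at ht1
      exact Or.inr (Or.inl ⟨b, by omega, trackSet_row S hb⟩)
  · have hi' : i + 1 < n := by omega
    have l1 := hd.2.2.1 i (i + 1) (by omega) hi'
    have l2 := hd.snd_lt hi'
    have e1 : (α i ⊓ α (i + 1)).1 = (α i).1 := min_eq_left l1.le
    have e2 : (α i ⊓ α (i + 1)).2 = (α (i + 1)).2 := min_eq_right l2.le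
    simp only [upD, Set.mem_ofPred_eq, e1, e2] at ht
    rcases hIA i (by omega) with ⟨p, hp, hp1, hp2⟩ | ⟨a, ha, haS⟩ | ⟨b, hb, -⟩
    · rcases hIA (i + 1) hi' with ⟨q, hq, hq1, hq2⟩ | ⟨a, ha, -⟩ | ⟨b, hb, -⟩
      · rw [hp, hq] at ht
        simp only [iotaZ, WithTop.coe_inj] at ht
        omega
      · rw [ha] at l2
        simp at l2
      · rw [hp, hb] at ht l2
        simp only [iotaZ, WithTop.coe_inj, WithTop.coe_lt_coe] at ht l2
        omega
    · rcases hIA (i + 1) hi' with ⟨q, hq, hq1, hq2⟩ | ⟨a', ha', -⟩ | ⟨b, hb, hbS⟩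
      · rw [ha, hq] at ht l1
        simp only [iotaZ, WithTop.coe_inj, WithTop.coe_lt_coe] at ht l1
        omega
      · rw [ha'] at l2
        simp at l2
      · refine beyondShape_of_corner hd hi' ha hb haS hbS ?_
        rw [ha, hb] at ht
        simp only [WithTop.coe_inj] at ht
        omega
    · rw [hb] at l1
      simp at l1
  · rcases hIA (n - 1) (by omega) with ⟨p, hp, hp1, hp2⟩ | ⟨a, ha, -⟩ | ⟨b, hb, -⟩
    · rw [hp] at ht1
      simp only [iotaZ, WithTop.coe_inj] at ht1
      omega
    · have h0 := hd.eq_zero_of_column (by omega) ha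
      obtain rfl : n = 1 := by omega
      rw [ha] at ht1
      simp only [WithTop.coe_inj] at ht1
      exact Or.inl ⟨a, by omega, trackSet_column S ha⟩
    · rw [hb] at ht1
      simp at ht1
  · exact absurd ht (nofin (n - 1) (by omega))

/-! ### Constructing beyond tracks -/

theorem mem_Gam {S : Set Z2} {w : Om} (hw : w ∈ Gam S) :
    (∃ p ∈ S, w = iotaZ p) ∨ (∃ a : ℤ, w = ((a : WithTop ℤ), ⊤) ∧ (a, (condE S).2) ∈ S) ∨
    (∃ b : ℤ, w = (⊤, (b : WithTop ℤ)) ∧ ((condE S).1, b) ∈ S) := by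
  rcases hw with ⟨p, hp, rfl⟩ | hw
  · exact Or.inl ⟨p, hp, rfl⟩
  · exact Or.inr hw

theorem iotaZ_zero : iotaZ 0 = 0 := rfl

theorem iotaZ_mem_ISet {S : Set Z2} {s : Z2} (hs : s ∈ S) (h0 : s ≠ 0)
    (hsum : ∀ p ∈ S, ∀ q ∈ S, p ≠ 0 → q ≠ 0 → p + q ≠ s) : iotaZ s ∈ ISet S := by
  refine ⟨Or.inl ⟨s, hs, rfl⟩, fun h => h0 ?_, fun b hb c hc he => ?_⟩
  · simp only [iotaZ, Prod.mk_eq_zero, WithTop.coe_eq_zero] at h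
    exact Prod.ext h.1 h.2
  rcases mem_Gam hb with ⟨p, hp, rfl⟩ | ⟨a, rfl, -⟩ | ⟨a, rfl, -⟩
  · rcases mem_Gam hc with ⟨q, hq, rfl⟩ | ⟨a, rfl, -⟩ | ⟨a, rfl, -⟩
    · by_cases hp0 : p = 0
      · right
        rw [he, hp0, iotaZ_zero, zero_add]
      by_cases hq0 : q = 0
      · left
        rw [he, hq0, iotaZ_zero, add_zero]
      refine absurd ?_ (hsum p hp q hq hp0 hq0)
      simp only [iotaZ, Prod.mk_add_mk, Prod.mk.injEq] at he
      exact Prod.ext (by exact_mod_cast he.1.symm) (by exact_mod_cast he.2.symm)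
    · simp [iotaZ] at he
    · simp [iotaZ] at he
  · have := congrArg Prod.snd he
    simp [iotaZ] at this
  · have := congrArg Prod.fst he
    simp [iotaZ] at this

theorem IsGood.column_mem_IA {S : Set Z2} (h : IsGood S) (hl : IsLocal S) {a N : ℤ}
    (ha : (a, (condE S).2) ∈ S) (hN : (condE S).2 ≤ N)
    (hsum : ∀ p ∈ S, ∀ q ∈ S, p ≠ 0 → q ≠ 0 → ∀ y, N ≤ y → p + q ≠ (a, y)) :
    (((a : WithTop ℤ), ⊤) : Om) ∈ IA S := by
  have c2 := h.one_le_condE_snd hl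
  have nz : ∀ x, ((x, N) : Z2) ≠ 0 := by
    intro x hx
    simp only [Prod.mk_eq_zero] at hx
    omega
  have mixed : ∀ x p, (x, (condE S).2) ∈ S → p ∈ S →
      ((a : WithTop ℤ), (⊤ : WithTop ℤ)) = ((x : WithTop ℤ), ⊤) + iotaZ p → p = 0 := by
    intro x p hx hp he
    by_contra hp0
    simp only [iotaZ, Prod.mk_add_mk, Prod.mk.injEq] at he
    have he1 : a = x + p.1 := by exact_mod_cast he.1
    have hp2 := (h.1 hp).2
    exact hsum _ (h.mem_column le_rfl hN hx) p hp (nz x) hp0 (N + p.2) (by omega)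
      (Prod.ext he1.symm rfl)
  have hS : (((a : WithTop ℤ), ⊤) : Om) ∈ Sinf S := Or.inl ⟨a, rfl, ha⟩
  refine ⟨⟨Or.inr hS, by simp, fun b hb c hc he => ?_⟩, Or.inr hS⟩
  rcases mem_Gam hb with ⟨p, hp, rfl⟩ | ⟨x, rfl, hx⟩ | ⟨x, rfl, -⟩
  · rcases mem_Gam hc with ⟨q, hq, rfl⟩ | ⟨x, rfl, hx⟩ | ⟨x, rfl, -⟩
    · simp only [iotaZ, Prod.mk_add_mk, Prod.mk.injEq, ← WithTop.coe_add,
        WithTop.top_ne_coe, and_false] at he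
    · right
      rw [add_comm] at he
      rw [he, mixed x p hx hp he, iotaZ_zero, add_zero]
    · simp [iotaZ] at he
  · rcases mem_Gam hc with ⟨q, hq, rfl⟩ | ⟨z, rfl, hz⟩ | ⟨z, rfl, -⟩
    · left
      rw [he, mixed x q hx hq he, iotaZ_zero, add_zero]
    · simp only [Prod.mk_add_mk, Prod.mk.injEq] at he
      have he1 : a = x + z := by exact_mod_cast he.1
      exact (hsum _ (h.mem_column le_rfl hN hx) _ (h.mem_column le_rfl hN hz) (nz x) (nz z)
        (N + N) (by omega) (Prod.ext he1.symm rfl)).elim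
    · simp at he
  · have := congrArg Prod.fst he
    simp at this

theorem swap_mem_Gam {S : Set Z2} {w : Om} (hw : w ∈ Gam S) : w.swap ∈ Gam (reflect S) := by
  rcases mem_Gam hw with ⟨p, hp, rfl⟩ | ⟨a, rfl, ha⟩ | ⟨a, rfl, ha⟩
  · exact Or.inl ⟨(p.2, p.1), hp, rfl⟩
  · exact Or.inr (Or.inr ⟨a, rfl, by rwa [condE_reflect]⟩)
  · exact Or.inr (Or.inl ⟨a, rfl, by rwa [condE_reflect]⟩)

theorem IsGood.row_mem_IA {S : Set Z2} (h : IsGood S) (hl : IsLocal S) {b N : ℤ}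
    (hb : ((condE S).1, b) ∈ S) (hN : (condE S).1 ≤ N)
    (hsum : ∀ p ∈ S, ∀ q ∈ S, p ≠ 0 → q ≠ 0 → ∀ x, N ≤ x → p + q ≠ (x, b)) :
    ((⊤, (b : WithTop ℤ)) : Om) ∈ IA S := by
  have nz : ∀ {p : Z2}, p ≠ 0 → ((p.2, p.1) : Z2) ≠ 0 := fun hp h0 => by
    simp only [Prod.mk_eq_zero] at h0
    exact hp (Prod.ext h0.2 h0.1)
  have key := h.reflect.column_mem_IA hl.reflect (a := b) (N := N) (by rwa [condE_reflect])
    (by rwa [condE_reflect]) (by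
    intro p hp q hq hp0 hq0 y hy he
    refine hsum _ hp _ hq (nz hp0) (nz hq0) y hy ?_
    have e1 := congrArg Prod.fst he
    have e2 := congrArg Prod.snd he
    exact Prod.ext e2 e1)
  have hS : ((⊤, (b : WithTop ℤ)) : Om) ∈ Sinf S := Or.inr ⟨b, rfl, hb⟩
  refine ⟨⟨Or.inr hS, by simp, fun u hu v hv he => ?_⟩, Or.inr hS⟩
  have := key.1.2.2 _ (swap_mem_Gam hu) _ (swap_mem_Gam hv)
    (by simpa using congrArg Prod.swap he)
  exact this.imp (fun h => by simpa using congrArg Prod.swap h)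
    (fun h => by simpa using congrArg Prod.swap h)

theorem BeyondShape.isBeyondTrack {S T : Set Z2} (h : IsGood S) (hl : IsLocal S)
    (hT : BeyondShape S T)
    (hsum : ∀ p ∈ S, ∀ q ∈ S, p ≠ 0 → q ≠ 0 → p + q ∉ T) : IsBeyondTrack S T := by
  have c1 := h.one_le_condE_fst hl
  have c2 := h.one_le_condE_snd hl
  have irr : ∀ s ∈ S, s ∈ T → s ≠ 0 → iotaZ s ∈ ISet S := fun s hs hsT h0 =>
    iotaZ_mem_ISet hs h0 fun p hp q hq hp0 hq0 he => hsum p hp q hq hp0 hq0 (he ▸ hsT)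
  rcases hT with ⟨a, ha, rfl⟩ | ⟨b, hb, rfl⟩ | ⟨a, b, hab, ha, hb, rfl⟩
  · have hmem : ∀ y, (condE S).2 ≤ y → (a, y) ∈ S := fun y hy =>
      h.mem_of_condE_le ⟨ha, hy⟩
    refine ⟨⟨1, fun _ => ((a : WithTop ℤ), ⊤), ⟨le_rfl, fun _ _ => ?_, fun i j _ _ => by omega,
      fun s _ hs => ?_, fun s hs hs' => ?_, fun i _ => by omega⟩, (trackSet_column S rfl).symm⟩,
      (a, (condE S).2), ⟨hmem _ le_rfl, rfl⟩, hmem _ le_rfl, ha, le_rfl⟩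
    · exact h.column_mem_IA hl (hmem _ le_rfl) le_rfl fun p hp q hq hp0 hq0 y hy he =>
        hsum p hp q hq hp0 hq0 ⟨he ▸ hmem y hy, by simp [he]⟩
    · simp [lowD2] at hs
    · have hsa : s.1 = a := by simpa [lowD1] using hs'
      refine irr s hs ⟨hs, hsa⟩ fun h0 => ?_
      have : s.1 = 0 := by simp [h0]
      omega
  · have hmem : ∀ x, (condE S).1 ≤ x → (x, b) ∈ S := fun x hx =>
      h.mem_of_condE_le ⟨hx, hb⟩
    refine ⟨⟨1, fun _ => (⊤, (b : WithTop ℤ)), ⟨le_rfl, fun _ _ => ?_, fun i j _ _ => by omega,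
      fun s hs hs' => ?_, fun s _ hs => ?_, fun i _ => by omega⟩, (trackSet_row S rfl).symm⟩,
      ((condE S).1, b), ⟨hmem _ le_rfl, rfl⟩, hmem _ le_rfl, le_rfl, hb⟩
    · exact h.row_mem_IA hl (hmem _ le_rfl) le_rfl fun p hp q hq hp0 hq0 y hy he =>
        hsum p hp q hq hp0 hq0 ⟨he ▸ hmem y hy, by simp [he]⟩
    · have hsa : s.2 = b := by simpa [lowD2] using hs'
      refine irr s hs ⟨hs, hsa⟩ fun h0 => ?_
      have : s.2 = 0 := by simp [h0]
      omega
    · simp [lowD1] at hs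
  · have ha0 : 0 ≤ a := (h.1 ha).1
    have hb0 : 0 ≤ b := (h.1 hb).2
    have hcol : ∀ y, (condE S).2 ≤ y → (a, y) ∈ S := fun y hy => h.mem_column le_rfl hy ha
    have hrow : ∀ x, (condE S).1 ≤ x → (x, b) ∈ S := fun x hx => h.mem_row le_rfl hx hb
    have cola : (((a : WithTop ℤ), ⊤) : Om) ∈ IA S :=
      h.column_mem_IA hl (N := max (condE S).2 (b + 1)) ha (le_max_left _ _)
        fun p hp q hq hp0 hq0 y hy he => by
          have hy' := max_le_iff.1 hy
          exact hsum p hp q hq hp0 hq0 (he ▸ ⟨hcol y hy'.1, Or.inl ⟨rfl, hy'.2⟩⟩)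
    have rowb : ((⊤, (b : WithTop ℤ)) : Om) ∈ IA S :=
      h.row_mem_IA hl (N := max (condE S).1 (a + 1)) hb (le_max_left _ _)
        fun p hp q hq hp0 hq0 x hx he => by
          have hx' := max_le_iff.1 hx
          exact hsum p hp q hq hp0 hq0 (he ▸ ⟨hrow x hx'.1, Or.inr ⟨rfl, hx'.2⟩⟩)
    refine ⟨⟨2, fun i => if i = 0 then ((a : WithTop ℤ), ⊤) else (⊤, (b : WithTop ℤ)),
      ⟨by omega, fun i _ => ?_, fun i j hij hj => ?_, fun s _ hs => ?_, fun s _ hs => ?_,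
        fun i hi => ?_⟩, (trackSet_corner S rfl rfl).symm⟩, ?_⟩
    · dsimp only
      split_ifs
      exacts [cola, rowb]
    · obtain rfl : i = 0 := by omega
      obtain rfl : j = 1 := by omega
      exact WithTop.coe_lt_top a
    · simp [lowD2] at hs
    · simp [lowD1] at hs
    · obtain rfl : i = 0 := by omega
      refine ⟨fun hle => ?_, fun hle => ?_, fun s hs hs' => ?_⟩
      · exact absurd hle.2 (by simp)
      · exact absurd hle.1 (by simp)
      · have hs'' : s ∈ DeltaUp (a, b) := by
          rw [← upD_inf]
          exact hs'
        refine irr s hs ⟨hs, hs''⟩ fun h0 => ?_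
        simp only [DeltaUp, h0, Set.mem_ofPred_eq, Prod.fst_zero, Prod.snd_zero] at hs''
        omega
    · rcases hab with hab | hab
      · have m := hcol (max (condE S).2 (b + 1)) (le_max_left _ _)
        exact ⟨_, ⟨m, Or.inl ⟨rfl, lt_of_lt_of_le (lt_add_one b) (le_max_right _ _)⟩⟩, m, hab,
          le_max_left _ _⟩
      · have m := hrow (max (condE S).1 (a + 1)) (le_max_left _ _)
        exact ⟨_, ⟨m, Or.inr ⟨rfl, lt_of_lt_of_le (lt_add_one a) (le_max_right _ _)⟩⟩, m,
          le_max_left _ _, hab⟩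

/-! ### The parent obtained by lowering the first coordinate of the conductor -/

/-- The set obtained from `S` by making every column from `f₁ = c₁ - 1` on equal to the union of
the columns of `S` at `f₁` and at `c₁`. -/
def columnParent (S : Set Z2) : Set Z2 :=
  {p | p ∈ S ∨ ((condE S).1 - 1 ≤ p.1 ∧
    (((condE S).1, p.2) ∈ S ∨ ((condE S).1 - 1, p.2) ∈ S))}

theorem subset_columnParent (S : Set Z2) : S ⊆ columnParent S := fun _ => Or.inl

/-- The elements of `columnParent S` in the columns from `f₁` on. -/
theorem IsGood.mem_columnParent_iff {S : Set Z2} (h : IsGood S) {p : Z2}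
    (hp : (condE S).1 - 1 ≤ p.1) : p ∈ columnParent S ↔
      ((condE S).1, p.2) ∈ S ∨ ((condE S).1 - 1, p.2) ∈ S := by
  refine ⟨fun hm => ?_, fun hm => Or.inr ⟨hp, hm⟩⟩
  rcases hm with hm | hm
  · rcases hp.eq_or_lt with h1 | h1
    · right
      rwa [h1]
    · exact Or.inl (h.mem_row (X := p.1) (by omega) le_rfl hm)
  · exact hm.2

theorem mem_of_mem_columnParent {S : Set Z2} {p : Z2} (hm : p ∈ columnParent S)
    (hp : p.1 < (condE S).1 - 1) : p ∈ S := by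
  rcases hm with hm | hm
  · exact hm
  · omega

theorem IsGood.exists_mem_of_mem_columnParent {S : Set Z2} (h : IsGood S) {p : Z2}
    (hm : p ∈ columnParent S) (hp : (condE S).1 - 1 ≤ p.1) :
    ∃ x, (condE S).1 - 1 ≤ x ∧ (x, p.2) ∈ S := by
  rcases (h.mem_columnParent_iff hp).1 hm with hm | hm
  · exact ⟨_, by omega, hm⟩
  · exact ⟨_, le_rfl, hm⟩

theorem IsGood.add_mem_of_mem_columnParent {S : Set Z2} (h : IsGood S) (hl : IsLocal S)
    (hf : 1 ≤ (condE S).1 - 1) {p q : Z2} (hp : p ∈ columnParent S) (hq : q ∈ columnParent S)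
    (hp0 : p ≠ 0) (hq0 : q ≠ 0) : p + q ∈ S := by
  have pos : ∀ {r : Z2}, r ∈ columnParent S → r ≠ 0 → 1 ≤ r.1 := by
    intro r hr hr0
    rcases hr with hr | hr
    · have := (h.1 hr).1
      by_contra hc
      exact hr0 (hl r hr (Or.inl (by omega)))
    · omega
  have lower : ∀ {r : Z2}, r ∈ columnParent S → r ≠ 0 → (condE S).1 - 1 ≤ r.1 →
      ∀ s ∈ S, s ≠ 0 → r + s ∈ S := by
    intro r hr hr0 hr1 s hs hs0
    obtain ⟨x, hx, hxS⟩ := h.exists_mem_of_mem_columnParent hr hr1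
    have hs1 := pos (Or.inl hs) hs0
    exact h.mem_row (X := x + s.1) (x := r.1 + s.1) (b := r.2 + s.2) (by omega) (by omega)
      (h.2.2.1 _ hxS _ hs)
  rcases lt_or_ge p.1 ((condE S).1 - 1) with h1 | h1
  · rcases lt_or_ge q.1 ((condE S).1 - 1) with h2 | h2
    · exact h.2.2.1 _ (mem_of_mem_columnParent hp h1) _ (mem_of_mem_columnParent hq h2)
    · rw [add_comm]
      exact lower hq hq0 h2 p (mem_of_mem_columnParent hp h1) hp0
  · rcases lt_or_ge q.1 ((condE S).1 - 1) with h2 | h2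
    · exact lower hp hp0 h1 q (mem_of_mem_columnParent hq h2) hq0
    · obtain ⟨x, hx, hxS⟩ := h.exists_mem_of_mem_columnParent hq h2
      have hx0 : ((x, q.2) : Z2) ≠ 0 := by
        intro h0
        simp only [Prod.mk_eq_zero] at h0
        omega
      have m := lower hp hp0 h1 _ hxS hx0
      exact h.mem_row (X := p.1 + x) (x := p.1 + q.1) (b := p.2 + q.2) (by omega) (by omega) m

theorem IsGood.mem_columnParent_of_le {S : Set Z2} (h : IsGood S) {y : Z2}
    (hy : ((condE S).1 - 1, (condE S).2) ≤ y) : y ∈ columnParent S :=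
  Or.inr ⟨hy.1, Or.inl (h.mem_of_condE_le ⟨le_rfl, hy.2⟩)⟩

theorem IsGood.isGood_columnParent {S : Set Z2} (h : IsGood S) (hl : IsLocal S)
    (hf : 1 ≤ (condE S).1 - 1) : IsGood (columnParent S) := by
  refine ⟨?_, Or.inl h.2.1, ?_, ?_, ⟨_, fun y hy => h.mem_columnParent_of_le hy⟩, ?_⟩
  · rintro p (hp | ⟨h1, h2 | h2⟩)
    · exact h.1 hp
    · exact ⟨by omega, (h.1 h2).2⟩
    · exact ⟨by omega, (h.1 h2).2⟩
  · intro p hp q hq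
    by_cases hp0 : p = 0
    · rwa [hp0, zero_add]
    by_cases hq0 : q = 0
    · rwa [hq0, add_zero]
    exact Or.inl (h.add_mem_of_mem_columnParent hl hf hp hq hp0 hq0)
  · have mixed : ∀ p ∈ columnParent S, ∀ q ∈ columnParent S, p.1 < (condE S).1 - 1 →
        (condE S).1 - 1 ≤ q.1 → p ⊓ q ∈ columnParent S := by
      intro p hp q hq h1 h2
      obtain ⟨x, hx, hxS⟩ := h.exists_mem_of_mem_columnParent hq h2
      have m := h.2.2.2.1 _ (mem_of_mem_columnParent hp h1) _ hxS
      have e : p ⊓ (x, q.2) = p ⊓ q :=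
        Prod.ext ((min_eq_left (by simp only; omega)).trans (min_eq_left (by omega)).symm) rfl
      exact Or.inl (e ▸ m)
    intro p hp q hq
    rcases lt_or_ge p.1 ((condE S).1 - 1) with h1 | h1
    · rcases lt_or_ge q.1 ((condE S).1 - 1) with h2 | h2
      · exact Or.inl (h.2.2.2.1 _ (mem_of_mem_columnParent hp h1) _
          (mem_of_mem_columnParent hq h2))
      · exact mixed p hp q hq h1 h2
    · rcases lt_or_ge q.1 ((condE S).1 - 1) with h2 | h2
      · rw [inf_comm]
        exact mixed q hq p hp h2 h1
      · have h12 : (condE S).1 - 1 ≤ (p ⊓ q).1 := le_min h1 h2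
        rw [h.mem_columnParent_iff h1] at hp
        rw [h.mem_columnParent_iff h2] at hq
        rw [h.mem_columnParent_iff h12]
        rcases min_choice p.2 q.2 with e | e
        · rwa [show (p ⊓ q).2 = p.2 from e]
        · rwa [show (p ⊓ q).2 = q.2 from e]
  · have right : ∀ {x y y' : ℤ}, y < y' → (x, y) ∈ columnParent S →
        (x, y') ∈ columnParent S → ∃ x', x < x' ∧ (x', y) ∈ columnParent S := by
      intro x y y' hy ha hb
      rcases lt_or_ge x ((condE S).1 - 1) with h1 | h1
      · obtain ⟨x', hx', hm⟩ := h.exists_right hy (mem_of_mem_columnParent ha h1)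
          (mem_of_mem_columnParent hb h1)
        exact ⟨x', hx', Or.inl hm⟩
      · exact ⟨x + 1, by omega, Or.inr ⟨by simp only; omega, (h.mem_columnParent_iff (p := (x, y)) h1).1 ha⟩⟩
    have above : ∀ {x x' y : ℤ}, x < x' → (x, y) ∈ columnParent S →
        (x', y) ∈ columnParent S → ∃ y', y < y' ∧ (x, y') ∈ columnParent S := by
      intro x x' y hx ha hb
      rcases lt_or_ge x ((condE S).1 - 1) with h1 | h1
      · have hb' : ∃ x'', x < x'' ∧ (x'', y) ∈ S := by
          rcases lt_or_ge x' ((condE S).1 - 1) with h2 | h2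
          · exact ⟨x', hx, mem_of_mem_columnParent hb h2⟩
          · obtain ⟨z, hz, hzS⟩ := h.exists_mem_of_mem_columnParent hb h2
            exact ⟨z, by omega, hzS⟩
        obtain ⟨x'', hx'', hm⟩ := hb'
        obtain ⟨y', hy', hm'⟩ := h.exists_above hx'' (mem_of_mem_columnParent ha h1) hm
        exact ⟨y', hy', Or.inl hm'⟩
      · exact ⟨max (condE S).2 (y + 1), lt_of_lt_of_le (lt_add_one y) (le_max_right _ _),
          h.mem_columnParent_of_le ⟨h1, le_max_left _ _⟩⟩
    rintro ⟨a1, a2⟩ ha ⟨b1, b2⟩ hb hab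
    constructor
    · rintro (rfl : a1 = b1)
      have hne : a2 ≠ b2 := fun e => hab (by rw [e])
      rcases hne.lt_or_gt with hlt | hlt
      · obtain ⟨x, hx, hm⟩ := right hlt ha hb
        exact ⟨_, hm, hx, by simp [hlt.le], fun _ => by simp [hlt.le]⟩
      · obtain ⟨x, hx, hm⟩ := right hlt hb ha
        exact ⟨_, hm, hx, by simp [hlt.le], fun _ => by simp [hlt.le]⟩
    · rintro (rfl : a2 = b2)
      have hne : a1 ≠ b1 := fun e => hab (by rw [e])
      rcases hne.lt_or_gt with hlt | hlt
      · obtain ⟨x, hx, hm⟩ := above hlt ha hb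
        exact ⟨_, hm, hx, by simp [hlt.le], fun _ => by simp [hlt.le]⟩
      · obtain ⟨x, hx, hm⟩ := above hlt hb ha
        exact ⟨_, hm, hx, by simp [hlt.le], fun _ => by simp [hlt.le]⟩

theorem IsLocal.isLocal_columnParent {S : Set Z2} (hl : IsLocal S)
    (hf : 1 ≤ (condE S).1 - 1) : IsLocal (columnParent S) := by
  have nz : ∀ {x y : ℤ}, 1 ≤ x → (x, y) ∈ S → y ≠ 0 := fun {x y} hx hm h0 => by
    have := hl _ hm (Or.inr h0)
    simp only [Prod.mk_eq_zero] at this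
    omega
  rintro p (hp | ⟨h1, h2 | h2⟩) hz
  · exact hl p hp hz
  · exact (hz.elim (fun h => by omega) (nz (by omega) h2)).elim
  · exact (hz.elim (fun h => by omega) (nz hf h2)).elim

theorem IsGood.condE_columnParent_le {S : Set Z2} (h : IsGood S) (hl : IsLocal S)
    (hf : 1 ≤ (condE S).1 - 1) :
    condE (columnParent S) ≤ ((condE S).1 - 1, (condE S).2) :=
  (h.isGood_columnParent hl hf).condE_le fun _ hy => h.mem_columnParent_of_le hy

theorem IsGood.beyondShape_columnParent {S : Set Z2} (h : IsGood S) (hl : IsLocal S)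
    (hf : 1 ≤ (condE S).1 - 1) :
    BeyondShape (columnParent S) (columnParent S \ S) := by
  have hP := h.isGood_columnParent hl hf
  have hc := h.condE_columnParent_le hl hf
  have fst_eq : ∀ p : Z2, p ∉ S → (condE S).1 - 1 ≤ p.1 → ((condE S).1, p.2) ∈ S →
      p.1 = (condE S).1 - 1 := by
    intro p hp h1 h2
    by_contra hne
    exact hp (h.mem_row (x := p.1) le_rfl (by omega) h2)
  by_cases hQ : ∃ y, ((condE S).1 - 1, y) ∈ S
  · obtain ⟨y₀, hy₀, hmax⟩ := Int.exists_greatest_of_bdd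
      (P := fun y => ((condE S).1 - 1, y) ∈ S) ⟨(condE S).2, fun z hz => by
        by_contra! hlt
        exact h.frobenius_column hlt.le hz⟩ hQ
    refine Or.inr (Or.inr ⟨(condE S).1 - 1, y₀, Or.inl hc.1,
      hP.mem_of_condE_le ⟨hc.1, le_rfl⟩, hP.mem_row hc.1 le_rfl (Or.inl hy₀), ?_⟩)
    ext ⟨x, y⟩
    refine and_congr_right fun hp => ⟨fun hpS => ?_, fun hd hpS => ?_⟩
    · obtain ⟨h1, h2 | h2⟩ := hp.resolve_left hpS
      · have hx := fst_eq _ hpS h1 h2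
        simp only at h1 h2 hx
        subst hx
        refine Or.inl ⟨rfl, ?_⟩
        show y₀ < y
        by_contra! hle
        have m := h.mem_min hy₀ h2
        rw [min_eq_left (by omega), min_eq_right hle] at m
        exact hpS m
      · simp only at h1 h2
        have hx : (condE S).1 - 1 < x := by
          refine h1.lt_of_ne fun he => hpS ?_
          rwa [← he]
        refine Or.inr ⟨?_, hx⟩
        rcases (hmax y h2).eq_or_lt with he | hlt
        · exact he
        · obtain ⟨x', hx', hm⟩ := h.exists_right hlt h2 hy₀
          exact absurd (h.mem_row (by omega) (by omega) hm) hpS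
    · rcases hd with ⟨h1, h2⟩ | ⟨h1, h2⟩
      · simp only at h1 h2
        subst h1
        have := hmax y hpS
        omega
      · simp only at h1 h2
        subst h1
        obtain ⟨y', hy', hm⟩ := h.exists_above h2 hy₀ hpS
        have := hmax y' hm
        omega
  · push Not at hQ
    refine Or.inl ⟨(condE S).1 - 1, hc.1, ?_⟩
    ext ⟨x, y⟩
    refine and_congr_right fun hp => ⟨fun hpS => ?_, fun hx hpS => ?_⟩
    · obtain ⟨h1, h2⟩ := hp.resolve_left hpS
      exact fst_eq _ hpS h1 (h2.resolve_right (hQ _))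
    · simp only [Set.mem_ofPred_eq] at hx
      subst hx
      exact hQ _ hpS

/-- Removing a column, or a half column and a half row, that reaches beyond the conductor from
`S` leaves a set whose `columnParent` is `S`. -/
theorem IsGood.eq_columnParent {S S' T : Set Z2} (h : IsGood S) (h' : IsGood S')
    (hT : S' = S \ T) {a : ℤ} (ha : (condE S).1 ≤ a)
    (hshape : T = S ∩ {p | p.1 = a} ∨
      ∃ b, ((condE S).1, b) ∈ S ∧ T = S ∩ DeltaUp (a, b)) :
    S = columnParent S' := by
  have hsub : S' ⊆ S := hT ▸ Set.sdiff_subset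
  have mem_of : ∀ q ∈ S, q ∉ T → q ∈ S' := fun q hq hqT => by
    rw [hT]
    exact ⟨hq, hqT⟩
  obtain ⟨N, hN⟩ : ∃ N, (condE S').2 ≤ N ∧ (condE S).2 ≤ N ∧
      ∀ x y, N ≤ y → (condE S).1 ≤ x → ((x, y) ∈ T ↔ x = a) := by
    have mem : ∀ x y, (condE S).2 ≤ y → (condE S).1 ≤ x → (x, y) ∈ S := fun x y hy hx =>
      h.mem_of_condE_le ⟨hx, hy⟩
    rcases hshape with rfl | ⟨b, -, rfl⟩
    · refine ⟨max (condE S').2 (condE S).2, le_max_left _ _, le_max_right _ _,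
        fun x y hy hx => ?_⟩
      exact and_iff_right (mem x y (by omega) hx)
    · refine ⟨max (max (condE S').2 (condE S).2) (b + 1), by omega, by omega,
        fun x y hy hx => ?_⟩
      refine (and_iff_right (mem x y (by omega) hx)).trans ?_
      simp only [DeltaUp, Set.mem_ofPred_eq]
      omega
  have memN : ∀ x, (condE S).1 ≤ x → ((x, N) ∈ S' ↔ x ≠ a) := by
    intro x hx
    rw [hT, Set.mem_sdiff, hN.2.2 x N le_rfl hx]
    exact and_iff_right (h.mem_of_condE_le ⟨hx, hN.2.1⟩)
  have ha1 : a < (condE S').1 := by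
    by_contra! hle
    exact (memN a ha).1 (h'.mem_of_condE_le ⟨hle, hN.1⟩) rfl
  obtain rfl : a = (condE S').1 - 1 := by
    by_contra hne
    exact h'.frobenius_column hN.1 ((memN ((condE S').1 - 1) (by omega)).2 (Ne.symm hne))
  apply Set.Subset.antisymm
  · intro p hp
    by_cases hpS : p ∈ S'
    · exact Or.inl hpS
    have hpT : p ∈ T := by
      by_contra hc
      exact hpS (mem_of p hp hc)
    have row : (condE S).1 ≤ p.1 → ((condE S').1, p.2) ∈ S := fun hp1 =>
      h.mem_row hp1 (by omega) hp
    rcases hshape with rfl | ⟨b, hb, rfl⟩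
    · have hp1 : p.1 = (condE S').1 - 1 := hpT.2
      refine Or.inr ⟨hp1.ge, Or.inl ?_⟩
      refine mem_of _ (row (by omega)) fun hm => ?_
      have : (condE S').1 = (condE S').1 - 1 := hm.2
      omega
    · rcases hpT.2 with ⟨h1, h2⟩ | ⟨h1, h2⟩
      · simp only at h1 h2
        refine Or.inr ⟨h1.ge, Or.inl ?_⟩
        refine mem_of _ (row (by omega)) fun hm => ?_
        have := hm.2
        simp only [DeltaUp, Set.mem_ofPred_eq] at this
        omega
      · simp only at h1 h2
        refine Or.inr ⟨h2.le, Or.inr ?_⟩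
        rw [h1]
        refine mem_of _ (h.mem_row le_rfl ha hb) fun hm => ?_
        have := hm.2
        simp only [DeltaUp, Set.mem_ofPred_eq] at this
        omega
  · rintro p (hp | ⟨h1, h2 | h2⟩)
    · exact hsub hp
    · exact h.mem_row (x := p.1) (by omega) (by omega) (hsub h2)
    · exact h.mem_row (x := p.1) ha (by omega) (hsub h2)

/-! ### Counting special parents -/

/-- The analogue of `columnParent` with the coordinates exchanged. -/
def rowParent (S : Set Z2) : Set Z2 := reflect (columnParent (reflect S))

theorem IsGood.specialParent_columnParent {S : Set Z2} (h : IsGood S) (hl : IsLocal S)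
    (hf : 1 ≤ (condE S).1 - 1) : SpecialParent (columnParent S) S :=
  ⟨h.isGood_columnParent hl hf, hl.isLocal_columnParent hf, _,
    (h.beyondShape_columnParent hl hf).isBeyondTrack (h.isGood_columnParent hl hf)
      (hl.isLocal_columnParent hf) fun _ hp _ hq hp0 hq0 hm =>
        hm.2 (h.add_mem_of_mem_columnParent hl hf hp hq hp0 hq0),
    (Set.sdiff_sdiff_cancel_left (subset_columnParent S)).symm⟩

theorem IsGood.specialParent_rowParent {S : Set Z2} (h : IsGood S) (hl : IsLocal S)
    (hf : 1 ≤ (condE S).2 - 1) : SpecialParent (rowParent S) S := by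
  have hf' : 1 ≤ (condE (_root_.reflect S)).1 - 1 := by rwa [condE_reflect]
  have hg := (h.reflect.isGood_columnParent hl.reflect hf').reflect
  have hl' := (hl.reflect.isLocal_columnParent hf').reflect
  have nz : ∀ {p : Z2}, p ≠ 0 → ((p.2, p.1) : Z2) ≠ 0 := fun hp h0 => by
    simp only [Prod.mk_eq_zero] at h0
    exact hp (Prod.ext h0.2 h0.1)
  refine ⟨hg, hl', rowParent S \ S, ?_, ?_⟩
  · refine BeyondShape.isBeyondTrack hg hl'
      (h.reflect.beyondShape_columnParent hl.reflect hf').reflect ?_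
    exact fun p hp q hq hp0 hq0 hm => hm.2
      (h.reflect.add_mem_of_mem_columnParent hl.reflect hf' hp hq (nz hp0) (nz hq0))
  · exact (Set.sdiff_sdiff_cancel_left fun p hp => Or.inl hp).symm

theorem SpecialParent.eq_columnParent_or_eq_rowParent {S S' : Set Z2} (h' : IsGood S')
    (hS : SpecialParent S S') : S = columnParent S' ∨ S = rowParent S' := by
  obtain ⟨h, -, T, hbt, hT⟩ := hS
  have row : ∀ b, (condE S).2 ≤ b → (T = S ∩ {p | p.2 = b} ∨
      ∃ a, (a, (condE S).2) ∈ S ∧ T = S ∩ DeltaUp (a, b)) → S = rowParent S' := by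
    intro b hb hshape
    have hT' : reflect S' = reflect S \ reflect T := by
      rw [hT]
      rfl
    have := h.reflect.eq_columnParent h'.reflect hT' (a := b) (by rwa [condE_reflect]) (by
      rcases hshape with rfl | ⟨a, ha, rfl⟩
      · exact Or.inl rfl
      · refine Or.inr ⟨a, by rwa [condE_reflect], ?_⟩
        ext p
        exact and_congr_right fun _ => or_comm)
    exact congrArg reflect this
  rcases hbt.beyondShape h with ⟨a, ha, hTa⟩ | ⟨b, hb, hTb⟩ | ⟨a, b, ha | hb, haS, hbS, hTab⟩
  · exact Or.inl (h.eq_columnParent h' hT ha (Or.inl hTa))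
  · exact Or.inr (row b hb (Or.inl hTb))
  · exact Or.inl (h.eq_columnParent h' hT ha (Or.inr ⟨b, hbS, hTab⟩))
  · exact Or.inr (row b hb (Or.inr ⟨a, haS, hTab⟩))

theorem IsGood.one_le_of_isLocal_columnParent {S : Set Z2} (h : IsGood S) (hl : IsLocal S)
    (hP : IsLocal (columnParent S)) : 1 ≤ (condE S).1 - 1 := by
  have c1 := h.one_le_condE_fst hl
  have c2 := h.one_le_condE_snd hl
  by_contra hc
  have := hP _ (h.mem_columnParent_of_le le_rfl) (Or.inl (by simp only; omega))
  simp only [Prod.mk_eq_zero] at this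
  omega

theorem IsGood.one_le_of_isLocal_rowParent {S : Set Z2} (h : IsGood S) (hl : IsLocal S)
    (hP : IsLocal (rowParent S)) : 1 ≤ (condE S).2 - 1 := by
  have := h.reflect.one_le_of_isLocal_columnParent hl.reflect hP.reflect
  rwa [condE_reflect] at this

theorem IsGood.columnParent_ne_rowParent {S : Set Z2} (h : IsGood S)
    (hf : condE S - ((1 : ℤ), (1 : ℤ)) ∉ S) : columnParent S ≠ rowParent S := by
  intro he
  have hm := h.mem_columnParent_of_le le_rfl
  rw [he] at hm
  have hn : ((condE S).1 - 1, (condE S).2) ∉ S := h.frobenius_column le_rfl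
  rcases hm with hm | ⟨-, hm⟩
  · exact hn hm
  · rw [condE_reflect] at hm
    exact hm.elim hn hf

/-- If `S' ≠ ℕ²(1,1)` is a local good semigroup whose
Frobenius vector `f(S') = (f₁,f₂)` does not belong to `S'`, then `S'` has
exactly `p` special parents, where `p = |{i ∈ {1,2} : f_i ≠ 0}|`. -/
theorem card_specialParents_of_frobenius_not_mem (S' : Set Z2) (hS' : IsGood S')
    (hl' : IsLocal S') (hne : S' ≠ N2oneone)
    (hf : condE S' - ((1 : ℤ), (1 : ℤ)) ∉ S') :
    {S : Set Z2 | SpecialParent S S'}.ncard =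
      (if (condE S' - ((1 : ℤ), (1 : ℤ))).1 ≠ 0 then 1 else 0) +
      (if (condE S' - ((1 : ℤ), (1 : ℤ))).2 ≠ 0 then 1 else 0) := by
  have c1 := hS'.one_le_condE_fst hl'
  have c2 := hS'.one_le_condE_snd hl'
  have hcol : SpecialParent (columnParent S') S' ↔ (condE S').1 - 1 ≠ 0 :=
    ⟨fun h => by have := hS'.one_le_of_isLocal_columnParent hl' h.2.1; omega,
      fun h => hS'.specialParent_columnParent hl' (by omega)⟩
  have hrow : SpecialParent (rowParent S') S' ↔ (condE S').2 - 1 ≠ 0 :=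
    ⟨fun h => by have := hS'.one_le_of_isLocal_rowParent hl' h.2.1; omega,
      fun h => hS'.specialParent_rowParent hl' (by omega)⟩
  have hdist := hS'.columnParent_ne_rowParent hf
  have hset : {S : Set Z2 | SpecialParent S S'} =
      {S | S = columnParent S' ∧ (condE S').1 - 1 ≠ 0} ∪
      {S | S = rowParent S' ∧ (condE S').2 - 1 ≠ 0} := by
    ext S
    constructor
    · intro hS
      rcases hS.eq_columnParent_or_eq_rowParent hS' with rfl | rfl
      · exact Or.inl ⟨rfl, hcol.1 hS⟩
      · exact Or.inr ⟨rfl, hrow.1 hS⟩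
    · rintro (⟨rfl, h⟩ | ⟨rfl, h⟩)
      · exact hcol.2 h
      · exact hrow.2 h
  rw [hset]
  simp only [Prod.fst_sub, Prod.snd_sub]
  by_cases h1 : (condE S').1 - 1 = 0 <;> by_cases h2 : (condE S').2 - 1 = 0
  · simp [h1, h2]
  · simp [h1, h2]
  · simp [h1, h2]
  · simp only [h1, h2, ne_eq, not_false_eq_true, and_true, if_true]
    exact Set.ncard_pair hdist
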